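/- Suppose φ : ℝ₊ → [0,1] is nondecreasing with φ(0)=0, φ(∞)=1, convex on [0,b*], concave on [b*,∞), and strictly convex near 0 (or vanishing near 0). If β[φ](b) = φ(b) for some b > 0, then b is the unique positive solution: for any p in the subgradient/supergradient ∂φ(b), the derivative of β[φ] at b satisfies ∇β[φ](b) − p < 0. -/

import Mathlib

open MeasureTheory Set Filter

/-- The moment `∫₀^c ψ(s) s^(γ-2) ds`. -/
noncomputable def lowerMoment (γ : ℝ) (ψ : ℝ → ℝ) (c : ℝ) : ℝ :=
  ∫ s in Ioc 0 c, ψ s * s ^ (γ - 2)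

/-- The moment `∫_c^∞ ψ(s) s^(γ-2) ds`. -/
noncomputable def upperMoment (γ : ℝ) (ψ : ℝ → ℝ) (c : ℝ) : ℝ :=
  ∫ s in Ioi c, ψ s * s ^ (γ - 2)

/-- The operator `β` applied to `ψ`, before normalization by `γ₂ - γ₁`. -/
noncomputable def rawBeta (γ₁ γ₂ : ℝ) (ψ : ℝ → ℝ) (c : ℝ) : ℝ :=
  γ₂ * (γ₂ - 1) * c ^ (1 - γ₂) * lowerMoment γ₂ ψ c
    + γ₁ * (γ₁ - 1) * c ^ (1 - γ₁) * upperMoment γ₁ ψ c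

/-- Integrability of `ψ` against both pieces of the kernel. -/
def KernelIntegrable (γ₁ γ₂ : ℝ) (ψ : ℝ → ℝ) : Prop :=
  ∀ c > 0, IntegrableOn (fun s => ψ s * s ^ (γ₂ - 2)) (Ioc 0 c) ∧
    IntegrableOn (fun s => ψ s * s ^ (γ₁ - 2)) (Ioi c)

lemma KernelIntegrable.sub {γ₁ γ₂ : ℝ} {ψ χ : ℝ → ℝ} (hψ : KernelIntegrable γ₁ γ₂ ψ)
    (hχ : KernelIntegrable γ₁ γ₂ χ) : KernelIntegrable γ₁ γ₂ (fun s => ψ s - χ s) := by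
  intro c hc
  simp only [sub_mul]
  exact ⟨(hψ c hc).1.sub (hχ c hc).1, (hψ c hc).2.sub (hχ c hc).2⟩

lemma rawBeta_sub {γ₁ γ₂ : ℝ} {ψ χ : ℝ → ℝ} (hψ : KernelIntegrable γ₁ γ₂ ψ)
    (hχ : KernelIntegrable γ₁ γ₂ χ) {c : ℝ} (hc : 0 < c) :
    rawBeta γ₁ γ₂ (fun s => ψ s - χ s) c = rawBeta γ₁ γ₂ ψ c - rawBeta γ₁ γ₂ χ c := by
  simp only [rawBeta, lowerMoment, upperMoment, sub_mul]
  rw [integral_sub (hψ c hc).1 (hχ c hc).1, integral_sub (hψ c hc).2 (hχ c hc).2]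
  ring

lemma integrableOn_Ioc_rpow {a : ℝ} (ha : -1 < a) {c : ℝ} (hc : 0 < c) :
    IntegrableOn (fun s : ℝ => s ^ a) (Ioc 0 c) :=
  (intervalIntegrable_iff_integrableOn_Ioc_of_le hc.le).1
    (intervalIntegral.intervalIntegrable_rpow' ha)

lemma integral_Ioc_rpow {a : ℝ} (ha : -1 < a) {c : ℝ} (hc : 0 < c) :
    ∫ s in Ioc 0 c, s ^ a = c ^ (a + 1) / (a + 1) := by
  rw [← intervalIntegral.integral_of_le hc.le, integral_rpow (Or.inl ha),
    Real.zero_rpow (by linarith), sub_zero]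

lemma affine_mul_rpow (v p a : ℝ) {s : ℝ} (hs : 0 < s) :
    (v + p * s) * s ^ a = v * s ^ a + p * s ^ (a + 1) := by
  rw [Real.rpow_add_one hs.ne']; ring

lemma kernelIntegrable_affine {γ₁ γ₂ : ℝ} (hγ₁ : γ₁ < 0) (hγ₂ : 1 < γ₂) (v p : ℝ) :
    KernelIntegrable γ₁ γ₂ (fun s => v + p * s) := by
  intro c hc
  constructor
  · refine IntegrableOn.congr_fun 
      (((integrableOn_Ioc_rpow (a := γ₂ - 2) (by linarith) hc).const_mul v).add
      ((integrableOn_Ioc_rpow (a := γ₂ - 2 + 1) (by linarith) hc).const_mul p)) ?_ measurableSet_Ioc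
    intro s hs
    exact (affine_mul_rpow v p _ hs.1).symm
  · refine IntegrableOn.congr_fun
      (((integrableOn_Ioi_rpow_of_lt (a := γ₁ - 2) (by linarith) hc).const_mul v).add
      ((integrableOn_Ioi_rpow_of_lt (a := γ₁ - 2 + 1) (by linarith) hc).const_mul p)) ?_
      measurableSet_Ioi
    intro s hs
    exact (affine_mul_rpow v p _ (hc.trans hs)).symm

lemma rawBeta_affine {γ₁ γ₂ : ℝ} (hγ₁ : γ₁ < 0) (hγ₂ : 1 < γ₂) (v p : ℝ) {c : ℝ} (hc : 0 < c) :
    rawBeta γ₁ γ₂ (fun s => v + p * s) c = (γ₂ - γ₁) * (v + p * c) := by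
  have hL : lowerMoment γ₂ (fun s => v + p * s) c
      = v * (c ^ (γ₂ - 1) / (γ₂ - 1)) + p * (c ^ γ₂ / γ₂) := by
    rw [lowerMoment, setIntegral_congr_fun measurableSet_Ioc
      (fun s hs => affine_mul_rpow v p (γ₂ - 2) hs.1), integral_add
      ((integrableOn_Ioc_rpow (by linarith) hc).const_mul v)
      ((integrableOn_Ioc_rpow (by linarith) hc).const_mul p), integral_const_mul,
      integral_const_mul, integral_Ioc_rpow (by linarith) hc, integral_Ioc_rpow (by linarith) hc]
    ring_nf
  have hU : upperMoment γ₁ (fun s => v + p * s) c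
      = v * (-c ^ (γ₁ - 1) / (γ₁ - 1)) + p * (-c ^ γ₁ / γ₁) := by
    rw [upperMoment, setIntegral_congr_fun measurableSet_Ioi
      (fun s hs => affine_mul_rpow v p (γ₁ - 2) (hc.trans hs)), integral_add
      ((integrableOn_Ioi_rpow_of_lt (by linarith) hc).const_mul v)
      ((integrableOn_Ioi_rpow_of_lt (by linarith) hc).const_mul p), integral_const_mul,
      integral_const_mul, integral_Ioi_rpow_of_lt (by linarith) hc,
      integral_Ioi_rpow_of_lt (by linarith) hc]
    ring_nf
  rw [rawBeta, hL, hU, Real.rpow_sub hc, Real.rpow_sub hc, Real.rpow_sub hc, Real.rpow_sub hc,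
    Real.rpow_one]
  have h1 := (Real.rpow_pos_of_pos hc γ₁).ne'
  have h2 := (Real.rpow_pos_of_pos hc γ₂).ne'
  have h3 : γ₂ - 1 ≠ 0 := by linarith
  have h4 : γ₁ - 1 ≠ 0 := by linarith
  have h5 : γ₂ ≠ 0 := by linarith
  have h6 := hγ₁.ne
  field_simp
  ring

lemma kernelIntegrable_of_monotoneOn {γ₁ γ₂ : ℝ} (hγ₁ : γ₁ < 0) (hγ₂ : 1 < γ₂) {φ : ℝ → ℝ}
    (hφ01 : ∀ x, φ x ∈ Icc (0 : ℝ) 1) (hmono : MonotoneOn φ (Ici 0)) :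
    KernelIntegrable γ₁ γ₂ φ := by
  intro c hc
  have hm {t : Set ℝ} (ht : t ⊆ Ici 0) : AEStronglyMeasurable φ (volume.restrict t) :=
    (aemeasurable_restrict_of_monotoneOn measurableSet_Ici hmono).aestronglyMeasurable.mono_set ht
  have hb (t : Set ℝ) : ∀ᵐ x ∂(volume.restrict t), ‖φ x‖ ≤ 1 :=
    Eventually.of_forall fun x => by
      rw [Real.norm_of_nonneg (hφ01 x).1]; exact (hφ01 x).2
  exact ⟨Integrable.bdd_mul (integrableOn_Ioc_rpow (by linarith) hc)
      (hm fun x hx => hx.1.le) (hb _),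
    Integrable.bdd_mul (integrableOn_Ioi_rpow_of_lt (by linarith) hc)
      (hm fun x hx => (hc.trans hx).le) (hb _)⟩

lemma integral_kernel_eq_rawBeta {γ₁ γ₂ : ℝ} {f : ℝ → ℝ}
    (hf : ∀ r, f r = (γ₂ - γ₁)⁻¹ *
      ((if 0 < r ∧ r ≤ 1 then γ₂ * (γ₂ - 1) * r ^ (γ₂ - 2) else 0)
        + (if 1 < r then γ₁ * (γ₁ - 1) * r ^ (γ₁ - 2) else 0)))
    {φ : ℝ → ℝ} (hφ : KernelIntegrable γ₁ γ₂ φ) {c : ℝ} (hc : 0 < c) :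
    ∫ r in Ioi (0 : ℝ), φ (c * r) * f r = (γ₂ - γ₁)⁻¹ * rawBeta γ₁ γ₂ φ c := by
  have hscale := integral_comp_mul_left_Ioi (fun s => φ s * f (c⁻¹ * s)) 0 hc
  simp only [inv_mul_cancel_left₀ hc.ne', mul_zero, smul_eq_mul] at hscale
  have hpow (γ : ℝ) {s : ℝ} (hs : 0 < s) :
      (c⁻¹ * s) ^ (γ - 2) = c * c ^ (1 - γ) * s ^ (γ - 2) := by
    rw [Real.mul_rpow (inv_pos.2 hc).le hs.le, Real.inv_rpow hc.le, ← Real.rpow_neg hc.le,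
      show -(γ - 2) = 1 + (1 - γ) by ring, Real.rpow_add hc, Real.rpow_one]
  have h1 : EqOn (fun s => φ s * f (c⁻¹ * s)) (fun s =>
      (γ₂ - γ₁)⁻¹ * (γ₂ * (γ₂ - 1)) * (c * c ^ (1 - γ₂)) * (φ s * s ^ (γ₂ - 2))) (Ioc 0 c) := by
    intro s hs
    have ha : 0 < c⁻¹ * s := mul_pos (inv_pos.2 hc) hs.1
    have hb : c⁻¹ * s ≤ 1 := by rw [inv_mul_le_iff₀ hc]; linarith [hs.2]
    simp only [hf, if_pos (And.intro ha hb), if_neg (not_lt.2 hb), hpow γ₂ hs.1]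
    ring
  have h2 : EqOn (fun s => φ s * f (c⁻¹ * s)) (fun s =>
      (γ₂ - γ₁)⁻¹ * (γ₁ * (γ₁ - 1)) * (c * c ^ (1 - γ₁)) * (φ s * s ^ (γ₁ - 2))) (Ioi c) := by
    intro s hs
    have hb : 1 < c⁻¹ * s := by rw [lt_inv_mul_iff₀ hc]; linarith [mem_Ioi.1 hs]
    have hn : ¬ (0 < c⁻¹ * s ∧ c⁻¹ * s ≤ 1) := fun h => absurd h.2 (not_le.2 hb)
    simp only [hf, if_pos hb, if_neg hn, hpow γ₁ (hc.trans hs)]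
    ring
  rw [hscale, ← Ioc_union_Ioi_eq_Ioi hc.le, setIntegral_union
    (Ioc_disjoint_Ioi le_rfl) measurableSet_Ioi
    (IntegrableOn.congr_fun ((hφ c hc).1.const_mul _) h1.symm measurableSet_Ioc)
    (IntegrableOn.congr_fun ((hφ c hc).2.const_mul _) h2.symm measurableSet_Ioi),
    setIntegral_congr_fun measurableSet_Ioc h1, setIntegral_congr_fun measurableSet_Ioi h2,
    integral_const_mul, integral_const_mul, rawBeta, lowerMoment, upperMoment]
  field_simp

lemma lowerMoment_eq_add {γ b₁ b₂ : ℝ} {ψ : ℝ → ℝ} (hb₁ : 0 < b₁) (h : b₁ ≤ b₂)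
    (hψ : IntegrableOn (fun s => ψ s * s ^ (γ - 2)) (Ioc 0 b₂)) :
    lowerMoment γ ψ b₂ = lowerMoment γ ψ b₁ + ∫ s in Ioc b₁ b₂, ψ s * s ^ (γ - 2) := by
  rw [lowerMoment, lowerMoment, ← Ioc_union_Ioc_eq_Ioc hb₁.le h, setIntegral_union
    (Ioc_disjoint_Ioc_of_le le_rfl) measurableSet_Ioc
    (hψ.mono_set (Ioc_subset_Ioc_right h)) (hψ.mono_set (Ioc_subset_Ioc_left hb₁.le))]

lemma upperMoment_eq_add {γ b₁ b₂ : ℝ} {ψ : ℝ → ℝ} (h : b₁ ≤ b₂)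
    (hψ : IntegrableOn (fun s => ψ s * s ^ (γ - 2)) (Ioi b₁)) :
    upperMoment γ ψ b₁ = (∫ s in Ioc b₁ b₂, ψ s * s ^ (γ - 2)) + upperMoment γ ψ b₂ := by
  rw [upperMoment, upperMoment, ← Ioc_union_Ioi_eq_Ioi h, setIntegral_union
    (Ioc_disjoint_Ioi le_rfl) measurableSet_Ioi
    (hψ.mono_set Ioc_subset_Ioi_self) (hψ.mono_set (Ioi_subset_Ioi h))]

lemma rpow_mul_rpow_lt {γ₁ γ₂ b₁ b₂ : ℝ} (hγ : γ₁ < γ₂) (hb₁ : 0 < b₁) (h : b₁ < b₂) :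
    b₂ ^ (1 - γ₂) * b₁ ^ (1 - γ₁) < b₁ ^ (1 - γ₂) * b₂ ^ (1 - γ₁) := by
  have hb₂ := hb₁.trans h
  have key := Real.rpow_lt_rpow hb₁.le h (sub_pos.2 hγ)
  have e₁ : b₁ ^ (1 - γ₁) = b₁ ^ (1 - γ₂) * b₁ ^ (γ₂ - γ₁) := by
    rw [← Real.rpow_add hb₁]; ring_nf
  have e₂ : b₂ ^ (1 - γ₁) = b₂ ^ (1 - γ₂) * b₂ ^ (γ₂ - γ₁) := by
    rw [← Real.rpow_add hb₂]; ring_nf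
  have hp := mul_pos (Real.rpow_pos_of_pos hb₁ (1 - γ₂)) (Real.rpow_pos_of_pos hb₂ (1 - γ₂))
  rw [e₁, e₂]
  nlinarith [mul_lt_mul_of_pos_left key hp]

/-- A zero of `rawBeta` cannot be followed by a second crossing when `ψ` is nonnegative with
positive mass before it and bounded by its final value after it. -/
lemma rawBeta_lt_of_nonneg {γ₁ γ₂ : ℝ} (hγ₁ : γ₁ < 0) (hγ₂ : 1 < γ₂) {ψ : ℝ → ℝ}
    (hψ : KernelIntegrable γ₁ γ₂ ψ) {b₁ b₂ : ℝ} (hb₁ : 0 < b₁) (h : b₁ < b₂)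
    (hL : 0 < lowerMoment γ₂ ψ b₁) (hM : ∀ s ∈ Ioc b₁ b₂, 0 ≤ ψ s ∧ ψ s ≤ ψ b₂)
    (hz : rawBeta γ₁ γ₂ ψ b₁ = 0) : rawBeta γ₁ γ₂ ψ b₂ < (γ₂ - γ₁) * ψ b₂ := by
  have hb₂ := hb₁.trans h
  have hv : 0 ≤ ψ b₂ := (hM b₂ ⟨h, le_rfl⟩).1
  have hU := upperMoment_eq_add h.le (hψ b₁ hb₁).2
  have hL₂ := lowerMoment_eq_add hb₁ h.le (hψ b₂ hb₂).1
  have hM₁ : 0 ≤ ∫ s in Ioc b₁ b₂, ψ s * s ^ (γ₁ - 2) :=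
    setIntegral_nonneg measurableSet_Ioc fun s hs =>
      mul_nonneg (hM s hs).1 (Real.rpow_nonneg (hb₁.trans hs.1).le _)
  have hM₂ : ∫ s in Ioc b₁ b₂, ψ s * s ^ (γ₂ - 2) ≤ ψ b₂ * (b₂ ^ (γ₂ - 1) / (γ₂ - 1)) := by
    have hi := integrableOn_Ioc_rpow (a := γ₂ - 2) (by linarith) hb₂
    calc _ ≤ ∫ s in Ioc b₁ b₂, ψ b₂ * s ^ (γ₂ - 2) :=
          setIntegral_mono_on ((hψ b₂ hb₂).1.mono_set (Ioc_subset_Ioc_left hb₁.le))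
            ((hi.mono_set (Ioc_subset_Ioc_left hb₁.le)).const_mul _) measurableSet_Ioc
            fun s hs => mul_le_mul_of_nonneg_right (hM s hs).2
              (Real.rpow_nonneg (hb₁.trans hs.1).le _)
      _ = ψ b₂ * ∫ s in Ioc b₁ b₂, s ^ (γ₂ - 2) := integral_const_mul _ _
      _ ≤ ψ b₂ * ∫ s in Ioc 0 b₂, s ^ (γ₂ - 2) :=
          mul_le_mul_of_nonneg_left (setIntegral_mono_set hi
            ((ae_restrict_iff' measurableSet_Ioc).2 (Eventually.of_forall fun s hs =>
              Real.rpow_nonneg hs.1.le _)) (Ioc_subset_Ioc_left hb₁.le).eventuallyLE) hv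
      _ = _ := by rw [integral_Ioc_rpow (by linarith) hb₂]; ring_nf
  have hpow := rpow_mul_rpow_lt (γ₁ := γ₁) (γ₂ := γ₂) (by linarith) hb₁ h
  have hX : b₂ ^ (1 - γ₂) * b₂ ^ (γ₂ - 1) = 1 := by
    rw [← Real.rpow_add hb₂]; simp
  have hc₁ : 0 < γ₁ * (γ₁ - 1) := by nlinarith
  have hc₂ : 0 < γ₂ * (γ₂ - 1) := by nlinarith
  have hX₂ := Real.rpow_pos_of_pos hb₂ (1 - γ₂)
  have hY₁ := Real.rpow_pos_of_pos hb₁ (1 - γ₁)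
  have hY₂ := Real.rpow_pos_of_pos hb₂ (1 - γ₁)
  rw [rawBeta] at hz ⊢
  rw [hU] at hz
  rw [hL₂]
  generalize (∫ s in Ioc b₁ b₂, ψ s * s ^ (γ₁ - 2)) = M₁ at *
  generalize (∫ s in Ioc b₁ b₂, ψ s * s ^ (γ₂ - 2)) = M₂ at *
  generalize lowerMoment γ₂ ψ b₁ = L at *
  generalize upperMoment γ₁ ψ b₂ = U at *
  generalize b₂ ^ (1 - γ₂) = X₂ at *
  generalize b₁ ^ (1 - γ₂) = X₁ at *
  generalize b₁ ^ (1 - γ₁) = Y₁ at *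
  generalize b₂ ^ (1 - γ₁) = Y₂ at *
  have hmid : γ₂ * (γ₂ - 1) * X₂ * M₂ ≤ (γ₂ - γ₁) * ψ b₂ := by
    calc _ ≤ γ₂ * (γ₂ - 1) * X₂ * (ψ b₂ * (b₂ ^ (γ₂ - 1) / (γ₂ - 1))) := by gcongr
      _ = γ₂ * ψ b₂ * (X₂ * b₂ ^ (γ₂ - 1)) := by
          field_simp [show γ₂ - 1 ≠ 0 by linarith]
      _ ≤ _ := by rw [hX]; nlinarith
  have hmain : γ₂ * (γ₂ - 1) * X₂ * L + γ₁ * (γ₁ - 1) * Y₂ * U < 0 := by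
    refine neg_of_mul_neg_right (a := Y₁) ?_ hY₁.le
    have e : Y₁ * (γ₂ * (γ₂ - 1) * X₂ * L + γ₁ * (γ₁ - 1) * Y₂ * U)
        = γ₂ * (γ₂ - 1) * L * (X₂ * Y₁ - X₁ * Y₂) - γ₁ * (γ₁ - 1) * Y₁ * Y₂ * M₁ := by
      linear_combination Y₂ * hz
    have t₁ : γ₂ * (γ₂ - 1) * L * (X₂ * Y₁ - X₁ * Y₂) < 0 :=
      mul_neg_of_pos_of_neg (by positivity) (sub_neg.2 hpow)
    have t₂ : 0 ≤ γ₁ * (γ₁ - 1) * Y₁ * Y₂ * M₁ := by positivity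
    linarith
  linarith

/-- Mirror image of `rawBeta_lt_of_nonneg`, going backwards from the second point. -/
lemma lt_rawBeta_of_nonpos {γ₁ γ₂ : ℝ} (hγ₁ : γ₁ < 0) (hγ₂ : 1 < γ₂) {ψ : ℝ → ℝ}
    (hψ : KernelIntegrable γ₁ γ₂ ψ) {b₁ b₂ : ℝ} (hb₁ : 0 < b₁) (h : b₁ < b₂)
    (hU : upperMoment γ₁ ψ b₂ < 0) (hM : ∀ s ∈ Icc b₁ b₂, ψ b₁ ≤ ψ s ∧ ψ s ≤ 0)
    (hz : rawBeta γ₁ γ₂ ψ b₂ = 0) : (γ₂ - γ₁) * ψ b₁ < rawBeta γ₁ γ₂ ψ b₁ := by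
  have hb₂ := hb₁.trans h
  have hv : ψ b₁ ≤ 0 := (hM b₁ ⟨le_rfl, h.le⟩).2
  have hU₁ := upperMoment_eq_add h.le (hψ b₁ hb₁).2
  have hL := lowerMoment_eq_add hb₁ h.le (hψ b₂ hb₂).1
  have hM₂ : ∫ s in Ioc b₁ b₂, ψ s * s ^ (γ₂ - 2) ≤ 0 :=
    setIntegral_nonpos measurableSet_Ioc fun s hs =>
      mul_nonpos_of_nonpos_of_nonneg (hM s (Ioc_subset_Icc_self hs)).2
        (Real.rpow_nonneg (hb₁.trans hs.1).le _)
  have hM₁ : ψ b₁ * (-b₁ ^ (γ₁ - 1) / (γ₁ - 1)) ≤ ∫ s in Ioc b₁ b₂, ψ s * s ^ (γ₁ - 2) := by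
    have hi := integrableOn_Ioi_rpow_of_lt (a := γ₁ - 2) (by linarith) hb₁
    calc _ = ψ b₁ * ∫ s in Ioi b₁, s ^ (γ₁ - 2) := by
          rw [integral_Ioi_rpow_of_lt (by linarith) hb₁]; ring_nf
      _ ≤ ψ b₁ * ∫ s in Ioc b₁ b₂, s ^ (γ₁ - 2) :=
          mul_le_mul_of_nonpos_left (setIntegral_mono_set hi
            ((ae_restrict_iff' measurableSet_Ioi).2 (Eventually.of_forall fun s hs =>
              Real.rpow_nonneg (hb₁.trans hs).le _)) Ioc_subset_Ioi_self.eventuallyLE) hv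
      _ = ∫ s in Ioc b₁ b₂, ψ b₁ * s ^ (γ₁ - 2) := (integral_const_mul _ _).symm
      _ ≤ _ :=
          setIntegral_mono_on ((hi.mono_set Ioc_subset_Ioi_self).const_mul _)
            ((hψ b₁ hb₁).2.mono_set Ioc_subset_Ioi_self) measurableSet_Ioc
            fun s hs => mul_le_mul_of_nonneg_right (hM s (Ioc_subset_Icc_self hs)).1
              (Real.rpow_nonneg (hb₁.trans hs.1).le _)
  have hpow := rpow_mul_rpow_lt (γ₁ := γ₁) (γ₂ := γ₂) (by linarith) hb₁ h
  have hY : b₁ ^ (1 - γ₁) * b₁ ^ (γ₁ - 1) = 1 := by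
    rw [← Real.rpow_add hb₁]; simp
  have hc₁ : 0 < γ₁ * (γ₁ - 1) := by nlinarith
  have hc₂ : 0 < γ₂ * (γ₂ - 1) := by nlinarith
  have hX₁ := Real.rpow_pos_of_pos hb₁ (1 - γ₂)
  have hX₂ := Real.rpow_pos_of_pos hb₂ (1 - γ₂)
  have hY₁ := Real.rpow_pos_of_pos hb₁ (1 - γ₁)
  rw [rawBeta] at hz ⊢
  rw [hL] at hz
  rw [hU₁]
  generalize (∫ s in Ioc b₁ b₂, ψ s * s ^ (γ₁ - 2)) = M₁ at *
  generalize (∫ s in Ioc b₁ b₂, ψ s * s ^ (γ₂ - 2)) = M₂ at *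
  generalize lowerMoment γ₂ ψ b₁ = L at *
  generalize upperMoment γ₁ ψ b₂ = U at *
  generalize b₂ ^ (1 - γ₂) = X₂ at *
  generalize b₁ ^ (1 - γ₂) = X₁ at *
  generalize b₁ ^ (1 - γ₁) = Y₁ at *
  generalize b₂ ^ (1 - γ₁) = Y₂ at *
  have hmid : (γ₂ - γ₁) * ψ b₁ ≤ γ₁ * (γ₁ - 1) * Y₁ * M₁ := by
    calc _ ≤ -γ₁ * ψ b₁ * (Y₁ * b₁ ^ (γ₁ - 1)) := by rw [hY]; nlinarith
      _ = γ₁ * (γ₁ - 1) * Y₁ * (ψ b₁ * (-b₁ ^ (γ₁ - 1) / (γ₁ - 1))) := by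
          field_simp [show γ₁ - 1 ≠ 0 by linarith]
      _ ≤ _ := by gcongr
  have hmain : 0 < γ₂ * (γ₂ - 1) * X₁ * L + γ₁ * (γ₁ - 1) * Y₁ * U := by
    refine pos_of_mul_pos_right (a := X₂) ?_ hX₂.le
    have e : X₂ * (γ₂ * (γ₂ - 1) * X₁ * L + γ₁ * (γ₁ - 1) * Y₁ * U)
        = γ₁ * (γ₁ - 1) * U * (X₂ * Y₁ - X₁ * Y₂) - γ₂ * (γ₂ - 1) * X₁ * X₂ * M₂ := by
      linear_combination X₁ * hz
    have t₁ : 0 < γ₁ * (γ₁ - 1) * U * (X₂ * Y₁ - X₁ * Y₂) :=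
      mul_pos_of_neg_of_neg (mul_neg_of_pos_of_neg hc₁ hU) (sub_neg.2 hpow)
    have t₂ : γ₂ * (γ₂ - 1) * X₁ * X₂ * M₂ ≤ 0 :=
      mul_nonpos_of_nonneg_of_nonpos (by positivity) hM₂
    linarith
  linarith

lemma deriv_rawBeta_of_zero {γ₁ γ₂ : ℝ} {ψ : ℝ → ℝ} (hψ : KernelIntegrable γ₁ γ₂ ψ)
    {b D : ℝ} (hb : 0 < b) (hψb : ψ b = 0) {S T : Set ℝ}
    [intervalIntegral.FTCFilter b (nhdsWithin b S) (nhdsWithin b T)]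
    (hS : UniqueDiffWithinAt ℝ S b) (hcont : ContinuousWithinAt ψ T b)
    (hD : HasDerivWithinAt (rawBeta γ₁ γ₂ ψ) D S b) :
    D = γ₂ * (γ₂ - 1) * ((1 - γ₂) * b ^ (-γ₂)) * lowerMoment γ₂ ψ b
      + γ₁ * (γ₁ - 1) * ((1 - γ₁) * b ^ (-γ₁)) * upperMoment γ₁ ψ b := by
  have hcont' (γ : ℝ) : ContinuousWithinAt (fun s => ψ s * s ^ (γ - 2)) T b :=
    hcont.mul (Real.continuousAt_rpow_const b _ (Or.inl hb.ne')).continuousWithinAt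
  have hnhds : Ioc 0 (b + 1) ∈ nhds b := Ioc_mem_nhds hb (by linarith)
  have hL : HasDerivWithinAt (fun c => ∫ s in (0 : ℝ)..c, ψ s * s ^ (γ₂ - 2)) 0 S b := by
    have := intervalIntegral.integral_hasDerivWithinAt_right (s := S) (t := T)
      ((intervalIntegrable_iff_integrableOn_Ioc_of_le hb.le).2 (hψ b hb).1)
      ⟨_, mem_nhdsWithin_of_mem_nhds hnhds,
        (hψ (b + 1) (by linarith)).1.aestronglyMeasurable⟩ (hcont' γ₂)
    simpa [hψb] using this
  have hU : HasDerivWithinAt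
      (fun c => upperMoment γ₁ ψ b - ∫ s in b..c, ψ s * s ^ (γ₁ - 2)) 0 S b := by
    have := intervalIntegral.integral_hasDerivWithinAt_right (s := S) (t := T)
      (IntervalIntegrable.refl (a := b) (μ := volume) (f := fun s => ψ s * s ^ (γ₁ - 2)))
      ⟨_, mem_nhdsWithin_of_mem_nhds (Ioi_mem_nhds (half_lt_self hb)),
        (hψ (b / 2) (half_pos hb)).2.aestronglyMeasurable⟩ (hcont' γ₁)
    simpa [hψb] using this.const_sub (upperMoment γ₁ ψ b)
  have hp (γ : ℝ) : HasDerivWithinAt (fun c : ℝ => γ * (γ - 1) * c ^ (1 - γ))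
      (γ * (γ - 1) * ((1 - γ) * b ^ (-γ))) S b := by
    have := (Real.hasDerivAt_rpow_const (x := b) (p := 1 - γ) (Or.inl hb.ne')).hasDerivWithinAt
      (s := S)
    rw [show 1 - γ - 1 = -γ by ring] at this
    exact this.const_mul _
  have hG := ((hp γ₂).mul hL).add ((hp γ₁).mul hU)
  have heq : ∀ c > 0, rawBeta γ₁ γ₂ ψ c
      = γ₂ * (γ₂ - 1) * c ^ (1 - γ₂) * (∫ s in (0 : ℝ)..c, ψ s * s ^ (γ₂ - 2))
        + γ₁ * (γ₁ - 1) * c ^ (1 - γ₁)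
          * (upperMoment γ₁ ψ b - ∫ s in b..c, ψ s * s ^ (γ₁ - 2)) := by
    intro c hc
    rw [rawBeta, lowerMoment, intervalIntegral.integral_of_le hc.le, upperMoment, upperMoment,
      ← intervalIntegral.integral_interval_add_Ioi (hψ b hb).2 (hψ c hc).2, add_sub_cancel_left]
  have hG' := hG.congr_of_eventuallyEq
    (mem_nhdsWithin_of_mem_nhds (Filter.mem_of_superset (Ioi_mem_nhds hb) heq)) (heq b hb)
  rw [hS.eq_deriv _ hD hG']
  simp [lowerMoment, intervalIntegral.integral_of_le hb.le]

lemma deriv_rawBeta_neg {γ₁ γ₂ : ℝ} (hγ₁ : γ₁ < 0) (hγ₂ : 1 < γ₂) {ψ : ℝ → ℝ}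
    (hψ : KernelIntegrable γ₁ γ₂ ψ) {b D : ℝ} (hb : 0 < b) (hψb : ψ b = 0)
    (hz : rawBeta γ₁ γ₂ ψ b = 0) (hD : HasDerivAt (rawBeta γ₁ γ₂ ψ) D b)
    (h : (0 < lowerMoment γ₂ ψ b ∧ ContinuousWithinAt ψ (Iic b) b) ∨
      (upperMoment γ₁ ψ b < 0 ∧ ContinuousWithinAt ψ (Ioi b) b)) : D < 0 := by
  have hDeq : D = γ₂ * (γ₂ - 1) * ((1 - γ₂) * b ^ (-γ₂)) * lowerMoment γ₂ ψ b
      + γ₁ * (γ₁ - 1) * ((1 - γ₁) * b ^ (-γ₁)) * upperMoment γ₁ ψ b := by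
    rcases h with ⟨-, hc⟩ | ⟨-, hc⟩
    · exact deriv_rawBeta_of_zero hψ hb hψb (uniqueDiffWithinAt_Iic b) hc hD.hasDerivWithinAt
    · exact deriv_rawBeta_of_zero hψ hb hψb (uniqueDiffWithinAt_Ici b) hc hD.hasDerivWithinAt
  have hpow (γ : ℝ) : b ^ (1 - γ) = b * b ^ (-γ) := by
    rw [sub_eq_add_neg, Real.rpow_add hb, Real.rpow_one]
  rw [rawBeta, hpow, hpow] at hz
  have hz' : γ₂ * (γ₂ - 1) * b ^ (-γ₂) * lowerMoment γ₂ ψ b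
      + γ₁ * (γ₁ - 1) * b ^ (-γ₁) * upperMoment γ₁ ψ b = 0 :=
    (mul_eq_zero_iff_left hb.ne').1 (by linear_combination hz)
  have hc₁ : 0 < γ₁ * (γ₁ - 1) := by nlinarith
  have hc₂ : 0 < γ₂ * (γ₂ - 1) := by nlinarith
  have hn : 0 < γ₂ - γ₁ := by linarith
  have hX := Real.rpow_pos_of_pos hb (-γ₂)
  have hY := Real.rpow_pos_of_pos hb (-γ₁)
  rcases h with ⟨hL, -⟩ | ⟨hU, -⟩
  · have e : D = -((γ₂ - γ₁) * (γ₂ * (γ₂ - 1) * b ^ (-γ₂) * lowerMoment γ₂ ψ b)) := by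
      linear_combination hDeq + (1 - γ₁) * hz'
    rw [e, neg_lt_zero]
    positivity
  · have e : D = (γ₂ - γ₁) * (γ₁ * (γ₁ - 1) * b ^ (-γ₁)) * upperMoment γ₁ ψ b := by
      linear_combination hDeq + (1 - γ₂) * hz'
    rw [e]
    exact mul_neg_of_pos_of_neg (by positivity) hU

lemma lowerMoment_pos {γ b x : ℝ} {ψ : ℝ → ℝ}
    (hψ : IntegrableOn (fun s => ψ s * s ^ (γ - 2)) (Ioc 0 b)) (h0 : ∀ s ∈ Ioc 0 b, 0 ≤ ψ s)
    (hx : 0 < x) (hxb : x ≤ b) (hpos : ∀ s ∈ Ioo 0 x, 0 < ψ s) : 0 < lowerMoment γ ψ b := by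
  refine (setIntegral_pos_iff_support_of_nonneg_ae ((ae_restrict_iff' measurableSet_Ioc).2
    (Eventually.of_forall fun s hs =>
      mul_nonneg (h0 s hs) (Real.rpow_nonneg hs.1.le _))) hψ).2 ?_
  refine lt_of_lt_of_le ?_ (measure_mono (s := Ioo 0 x) fun s hs =>
    ⟨(mul_pos (hpos s hs) (Real.rpow_pos_of_pos hs.1 _)).ne', hs.1, hs.2.le.trans hxb⟩)
  simpa using hx

lemma upperMoment_pos {γ b x : ℝ} {ψ : ℝ → ℝ} (hb : 0 < b)
    (hψ : IntegrableOn (fun s => ψ s * s ^ (γ - 2)) (Ioi b)) (h0 : ∀ s ∈ Ioi b, 0 ≤ ψ s)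
    (hpos : ∀ s > b, x < s → 0 < ψ s) : 0 < upperMoment γ ψ b := by
  refine (setIntegral_pos_iff_support_of_nonneg_ae ((ae_restrict_iff' measurableSet_Ioi).2
    (Eventually.of_forall fun s hs =>
      mul_nonneg (h0 s hs) (Real.rpow_nonneg (hb.trans hs).le _))) hψ).2 ?_
  refine lt_of_lt_of_le ?_ (measure_mono (s := Ioi (max b x)) fun s hs =>
    ⟨(mul_pos (hpos s ((le_max_left _ _).trans_lt hs) ((le_max_right _ _).trans_lt hs))
      (Real.rpow_pos_of_pos (hb.trans ((le_max_left _ _).trans_lt hs)) _)).ne',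
      (le_max_left b x).trans_lt (mem_Ioi.1 hs)⟩)
  simp

lemma upperMoment_neg {γ b x : ℝ} {ψ : ℝ → ℝ} (hb : 0 < b)
    (hψ : IntegrableOn (fun s => ψ s * s ^ (γ - 2)) (Ioi b)) (h0 : ∀ s ∈ Ioi b, ψ s ≤ 0)
    (hneg : ∀ s > b, x < s → ψ s < 0) : upperMoment γ ψ b < 0 := by
  have := upperMoment_pos (γ := γ) (ψ := fun s => -ψ s) (x := x) hb
    (by simp only [neg_mul]; exact hψ.neg) (fun s hs => neg_nonneg.2 (h0 s hs))
    (fun s hs hx => neg_pos.2 (hneg s hs hx))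
  simp only [upperMoment, neg_mul, integral_neg, neg_pos] at this
  exact this

lemma ConvexOn.exists_subgradient {S : Set ℝ} {g : ℝ → ℝ} (hg : ConvexOn ℝ S g) {x : ℝ}
    (hx : x ∈ interior S) : ∃ p, ∀ y ∈ S, g x + p * (y - x) ≤ g y := by
  refine ⟨derivWithin g (Ioi x) x, fun y hy => ?_⟩
  rcases lt_trichotomy x y with h | rfl | h
  · have := hg.rightDeriv_le_slope_of_mem_interior hx hy h
    rw [slope_def_field, le_div_iff₀ (sub_pos.2 h)] at this
    linarith
  · simp
  · have := (hg.slope_le_leftDeriv_of_mem_interior hy hx h).trans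
      (hg.leftDeriv_le_rightDeriv_of_mem_interior hx)
    rw [slope_def_field, div_le_iff₀ (sub_pos.2 h)] at this
    linarith

lemma ConcaveOn.exists_supergradient {S : Set ℝ} {g : ℝ → ℝ} (hg : ConcaveOn ℝ S g) {x : ℝ}
    (hx : x ∈ interior S) : ∃ p, ∀ y ∈ S, g y ≤ g x + p * (y - x) := by
  obtain ⟨p, hp⟩ := hg.neg.exists_subgradient hx
  refine ⟨-p, fun y hy => ?_⟩
  have := hp y hy
  simp only [Pi.neg_apply] at this
  linarith

lemma ConvexOn.mul_sub_le_sub {S : Set ℝ} {g : ℝ → ℝ} (hg : ConvexOn ℝ S g) {p x₀ x y : ℝ}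
    (hx₀ : x₀ ∈ S) (hy : y ∈ S) (h₀ : x₀ ≤ x) (h : x ≤ y)
    (hp : ∀ z ∈ S, g x₀ + p * (z - x₀) ≤ g z) : p * (y - x) ≤ g y - g x := by
  have hx : x ∈ S := hg.1.ordConnected.out hx₀ hy ⟨h₀, h⟩
  rcases h₀.eq_or_lt with rfl | h₀
  · linarith [hp y hy]
  rcases h.eq_or_lt with rfl | h
  · simp
  have := hg.slope_mono_adjacent hx₀ hy h₀ h
  rw [← le_div_iff₀ (sub_pos.2 h)]
  refine le_trans ?_ this
  rw [le_div_iff₀ (sub_pos.2 h₀)]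
  linarith [hp x hx]

lemma ConcaveOn.mul_sub_le_sub {S : Set ℝ} {g : ℝ → ℝ} (hg : ConcaveOn ℝ S g) {p x₀ x y : ℝ}
    (hx₀ : x₀ ∈ S) (hx : x ∈ S) (h : x ≤ y) (h₀ : y ≤ x₀)
    (hp : ∀ z ∈ S, g z ≤ g x₀ + p * (z - x₀)) : p * (y - x) ≤ g y - g x := by
  have hy : y ∈ S := hg.1.ordConnected.out hx hx₀ ⟨h, h₀⟩
  rcases h₀.eq_or_lt with rfl | h₀
  · linarith [hp x hx]
  rcases h.eq_or_lt with rfl | h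
  · simp
  have := hg.slope_anti_adjacent hx hx₀ h h₀
  rw [← le_div_iff₀ (sub_pos.2 h)]
  refine le_trans ?_ this
  rw [le_div_iff₀ (sub_pos.2 h₀)]
  linarith [hp y hy]

lemma ConvexOn.continuousWithinAt_Iic_of_support {g : ℝ → ℝ} {b c p : ℝ} (hb : 0 < b) (hbc : b ≤ c)
    (hg : ConvexOn ℝ (Icc 0 c) g) (hp : ∀ x ∈ Icc 0 c, g b + p * (x - b) ≤ g x) :
    ContinuousWithinAt g (Iic b) b := by
  have hup : ∀ x ∈ Ioc 0 b, g x ≤ g b + (g b - g 0) / b * (x - b) := by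
    intro x hx
    rcases hx.2.eq_or_lt with rfl | h
    · simp
    have := hg.secant_mono_aux1 (x := 0) (y := x) (z := b) ⟨le_rfl, hb.le.trans hbc⟩
      ⟨hb.le, hbc⟩ hx.1 h
    rw [div_mul_eq_mul_div, ← sub_le_iff_le_add', le_div_iff₀ hb]
    linarith
  have hlim (q : ℝ) : Tendsto (fun x => g b + q * (x - b)) (nhdsWithin b (Iic b)) (nhds (g b)) := by
    have : ContinuousWithinAt (fun x => g b + q * (x - b)) (Iic b) b := by fun_prop
    simpa [ContinuousWithinAt] using this
  have hmem : Ioc 0 b ∈ nhdsWithin b (Iic b) := Ioc_mem_nhdsLE hb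
  exact tendsto_of_tendsto_of_tendsto_of_le_of_le' (hlim p) (hlim _)
    (mem_of_superset hmem fun x hx => hp x ⟨hx.1.le, hx.2.trans hbc⟩)
    (mem_of_superset hmem hup)

lemma ConcaveOn.continuousWithinAt_Ioi_of_support {g : ℝ → ℝ} {b c p : ℝ} (hbc : c ≤ b)
    (hg : ConcaveOn ℝ (Ici c) g) (hp : ∀ x ∈ Ici c, g x ≤ g b + p * (x - b)) :
    ContinuousWithinAt g (Ioi b) b := by
  have hlow : ∀ x ∈ Ioo b (b + 1), g b + (g (b + 1) - g b) * (x - b) ≤ g x := by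
    intro x hx
    have := hg.neg.secant_mono_aux1 (x := b) (y := x) (z := b + 1) hbc
      (hbc.trans (by linarith)) hx.1 hx.2
    simp only [Pi.neg_apply] at this
    linarith
  have hlim (q : ℝ) : Tendsto (fun x => g b + q * (x - b)) (nhdsWithin b (Ioi b)) (nhds (g b)) := by
    have : ContinuousWithinAt (fun x => g b + q * (x - b)) (Ioi b) b := by fun_prop
    simpa [ContinuousWithinAt] using this
  have hmem : Ioo b (b + 1) ∈ nhdsWithin b (Ioi b) := Ioo_mem_nhdsGT (by linarith)
  exact tendsto_of_tendsto_of_tendsto_of_le_of_le' (hlim _) (hlim p)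
    (mem_of_superset hmem hlow)
    (mem_of_superset hmem fun x hx => hp x (hbc.trans hx.1.le))

/-- A convex function which vanishes or is strictly convex near `0` has strictly positive gap
to any supporting line at a point where it is positive. -/
lemma exists_pos_gap {φ : ℝ → ℝ} {b c p : ℝ} (hb : 0 < b) (hbc : b ≤ c) (hφ0 : φ 0 = 0)
    (hφb : 0 < φ b)
    (hnear0 : (∃ ε > 0, ∀ x ∈ Icc (0 : ℝ) ε, φ x = 0)
      ∨ (∃ ε > 0, StrictConvexOn ℝ (Icc (0 : ℝ) ε) φ))
    (hp : ∀ x ∈ Icc 0 c, φ b + p * (x - b) ≤ φ x) :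
    ∃ x, 0 < x ∧ x ≤ b ∧ ∀ s ∈ Ioo 0 x, 0 < φ s - (φ b - p * b + p * s) := by
  rcases hnear0 with ⟨ε, hε, hz⟩ | ⟨ε, hε, hconv⟩
  · have hv : φ b - p * b ≤ 0 := by
      have := hp 0 ⟨le_rfl, hb.le.trans hbc⟩
      linarith
    have hppos : 0 < p := by
      by_contra! h
      nlinarith
    have hεb : ε < b := by
      by_contra! h
      linarith [hz b ⟨hb.le, h⟩]
    refine ⟨ε, hε, hεb.le, fun s hs => ?_⟩
    have h₁ := hp ε ⟨hε.le, hεb.le.trans hbc⟩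
    rw [hz ε ⟨hε.le, le_rfl⟩] at h₁
    rw [hz s ⟨hs.1.le, hs.2.le⟩]
    nlinarith [mul_pos hppos (sub_pos.2 hs.2)]
  · set m := min ε b with hm
    have hmpos : 0 < m := lt_min hε hb
    by_cases hex : ∃ x ∈ Ioo 0 m, φ x - (φ b - p * b + p * x) ≤ 0
    · obtain ⟨x, hx, hx0⟩ := hex
      have hxε : x < ε := hx.2.trans_le (min_le_left _ _)
      have hxb : x < b := hx.2.trans_le (min_le_right _ _)
      refine ⟨x, hx.1, hxb.le, fun s hs' => ?_⟩
      by_contra! hs0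
      have hmid := hconv.2 ⟨hs'.1.le, (hs'.2.trans hxε).le⟩
        ⟨hx.1.le, hxε.le⟩ hs'.2.ne (one_half_pos (α := ℝ)) one_half_pos
        (by norm_num)
      simp only [smul_eq_mul] at hmid
      have := hp (1 / 2 * s + 1 / 2 * x) ⟨by linarith [hs'.1, hx.1], by linarith [hs'.2]⟩
      linarith
    · push Not at hex
      exact ⟨m, hmpos, min_le_right _ _, hex⟩

lemma exists_neg_gap {φ : ℝ → ℝ} {b c p : ℝ} (hbc : c ≤ b) (hφ1 : ∀ x, φ x ≤ 1)
    (hφtop : Tendsto φ atTop (nhds 1)) (hφb : φ b < 1)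
    (hp : ∀ x ∈ Ici c, φ x ≤ φ b + p * (x - b)) :
    ∃ K, ∀ s > b, K < s → φ s - (φ b - p * b + p * s) < 0 := by
  obtain ⟨x, hx, hxb⟩ :=
    ((hφtop.eventually (lt_mem_nhds hφb)).and (eventually_gt_atTop b)).exists
  have hppos : 0 < p := by
    have := hp x (hbc.trans hxb.le)
    by_contra! h
    nlinarith
  refine ⟨b + (1 - φ b) / p, fun s _ hs => ?_⟩
  have : (1 - φ b) / p < s - b := by linarith
  rw [div_lt_iff₀ hppos] at this
  linarith [hφ1 s]

/-- Fixed points of `β` on a nontrivial profile take values strictly between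
`0` and `1`. -/
lemma fixedPoint_mem_Ioo {γ₁ γ₂ : ℝ} (hγ₁ : γ₁ < 0) (hγ₂ : 1 < γ₂) {φ : ℝ → ℝ}
    (hφ : KernelIntegrable γ₁ γ₂ φ) (hφ01 : ∀ x, φ x ∈ Icc (0 : ℝ) 1)
    (hφ0 : φ 0 = 0) (hφtop : Tendsto φ atTop (nhds 1)) {bs : ℝ} (hbs : 0 < bs)
    (hconv : ConvexOn ℝ (Icc 0 bs) φ) {b : ℝ} (hb : 0 < b)
    (hfix : rawBeta γ₁ γ₂ φ b = (γ₂ - γ₁) * φ b) : φ b ∈ Ioo (0 : ℝ) 1 := by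
  have hc₁ : 0 < γ₁ * (γ₁ - 1) := by nlinarith
  have hc₂ : 0 < γ₂ * (γ₂ - 1) := by nlinarith
  have hX := Real.rpow_pos_of_pos hb (1 - γ₂)
  have hY := Real.rpow_pos_of_pos hb (1 - γ₁)
  constructor
  · refine (hφ01 b).1.lt_of_ne' fun h0 => ?_
    obtain ⟨K, hK⟩ := eventually_atTop.1 (hφtop.eventually (lt_mem_nhds one_pos))
    have hU : 0 < upperMoment γ₁ φ b := upperMoment_pos (x := K) hb (hφ b hb).2
      (fun s _ => (hφ01 s).1) fun s _ hs => hK s hs.le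
    have hL : 0 ≤ lowerMoment γ₂ φ b := setIntegral_nonneg measurableSet_Ioc fun s hs =>
      mul_nonneg (hφ01 s).1 (Real.rpow_nonneg hs.1.le _)
    rw [h0, mul_zero, rawBeta] at hfix
    have : 0 < γ₁ * (γ₁ - 1) * b ^ (1 - γ₁) * upperMoment γ₁ φ b := by positivity
    have : 0 ≤ γ₂ * (γ₂ - 1) * b ^ (1 - γ₂) * lowerMoment γ₂ φ b := by positivity
    linarith
  · refine (hφ01 b).2.lt_of_ne fun h1 => ?_
    have hone := kernelIntegrable_affine hγ₁ hγ₂ 1 0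
    have hχ := hone.sub hφ
    have hz := rawBeta_sub hone hφ hb
    rw [rawBeta_affine hγ₁ hγ₂ 1 0 hb, hfix, h1] at hz
    have hnonneg (s : ℝ) : 0 ≤ 1 + 0 * s - φ s := by linarith [(hφ01 s).2]
    have hpos : ∀ s ∈ Ioo 0 (min bs b), 0 < 1 + 0 * s - φ s := by
      intro s hs
      have hsb : s < bs := hs.2.trans_le (min_le_left _ _)
      have := hconv.secant_mono_aux1 ⟨le_rfl, hbs.le⟩ ⟨hbs.le, le_rfl⟩ hs.1 hsb
      rw [hφ0] at this
      nlinarith [(hφ01 bs).2, hs.1, mul_le_mul_of_nonneg_left (hφ01 bs).2 hs.1.le]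
    have hL := lowerMoment_pos (hχ b hb).1 (fun s _ => hnonneg s) (lt_min hbs hb)
      (min_le_right _ _) hpos
    have hU : 0 ≤ upperMoment γ₁ (fun s => 1 + 0 * s - φ s) b :=
      setIntegral_nonneg measurableSet_Ioi fun s hs =>
        mul_nonneg (hnonneg s) (Real.rpow_nonneg (hb.trans hs).le _)
    rw [rawBeta] at hz
    have : 0 < γ₂ * (γ₂ - 1) * b ^ (1 - γ₂) * lowerMoment γ₂ (fun s => 1 + 0 * s - φ s) b := by
      positivity
    have : 0 ≤ γ₁ * (γ₁ - 1) * b ^ (1 - γ₁) * upperMoment γ₁ (fun s => 1 + 0 * s - φ s) b := by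
      positivity
    linarith

/-- Uniqueness of the fixed point of `β[φ]`: for `φ : ℝ₊ → [0,1]` nondecreasing with
`φ(0) = 0`, `φ(∞) = 1`, convex on `[0,b*]`, concave on `[b*,∞)`, and either vanishing
near `0` or strictly convex near `0`, any positive solution `b` of `β[φ](b) = φ(b)` is
unique and satisfies `∇β[φ](b) − p < 0` for every sub/supergradient `p ∈ ∂φ(b)`. -/
theorem stmt_13 (γ₁ γ₂ : ℝ) (hγ₁ : γ₁ < 0) (hγ₂ : 1 < γ₂)
    (f : ℝ → ℝ)
    (hf : ∀ r, f r = (γ₂ - γ₁)⁻¹ *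
      ((if 0 < r ∧ r ≤ 1 then γ₂ * (γ₂ - 1) * r ^ (γ₂ - 2) else 0)
        + (if 1 < r then γ₁ * (γ₁ - 1) * r ^ (γ₁ - 2) else 0)))
    (φ : ℝ → ℝ) (hφ01 : ∀ x, φ x ∈ Icc (0 : ℝ) 1)
    (hmono : ∀ x y, 0 ≤ x → x ≤ y → φ x ≤ φ y)
    (hφ0 : φ 0 = 0) (hφtop : Tendsto φ atTop (nhds 1))
    (bs : ℝ) (hbs : 0 < bs)
    (hconv : ConvexOn ℝ (Icc 0 bs) φ) (hconc : ConcaveOn ℝ (Ici bs) φ)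
    (hnear0 : (∃ ε > 0, ∀ x ∈ Icc (0 : ℝ) ε, φ x = 0)
      ∨ (∃ ε > 0, StrictConvexOn ℝ (Icc (0 : ℝ) ε) φ))
    (b : ℝ) (hb : 0 < b)
    (hfix : (∫ r in Ioi (0 : ℝ), φ (b * r) * f r) = φ b) :
    (∀ p : ℝ,
        ((b ≤ bs ∧ ∀ x ∈ Icc (0 : ℝ) bs, φ b + p * (x - b) ≤ φ x)
          ∨ (bs ≤ b ∧ ∀ x ∈ Ici bs, φ x ≤ φ b + p * (x - b))) →
        ∀ d : ℝ, HasDerivAt (fun c => ∫ r in Ioi (0 : ℝ), φ (c * r) * f r) d b →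
          d - p < 0)
    ∧ ∀ b' : ℝ, 0 < b' → (∫ r in Ioi (0 : ℝ), φ (b' * r) * f r) = φ b' → b' = b := by
  have hn : 0 < γ₂ - γ₁ := by linarith
  have hφ : KernelIntegrable γ₁ γ₂ φ :=
    kernelIntegrable_of_monotoneOn hγ₁ hγ₂ hφ01 fun x hx y _ h => hmono x y hx h
  have hβ {c : ℝ} (hc : 0 < c) := integral_kernel_eq_rawBeta hf hφ hc
  have hraw {c : ℝ} (hc : 0 < c) (h : (∫ r in Ioi (0 : ℝ), φ (c * r) * f r) = φ c) :
      rawBeta γ₁ γ₂ φ c = (γ₂ - γ₁) * φ c := by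
    rw [← h, hβ hc, mul_inv_cancel_left₀ hn.ne']
  have hψ (v p : ℝ) : KernelIntegrable γ₁ γ₂ (fun s => φ s - (v + p * s)) :=
    hφ.sub (kernelIntegrable_affine hγ₁ hγ₂ v p)
  have hrawψ (v p : ℝ) {c : ℝ} (hc : 0 < c) : rawBeta γ₁ γ₂ (fun s => φ s - (v + p * s)) c
      = rawBeta γ₁ γ₂ φ c - (γ₂ - γ₁) * (v + p * c) := by
    rw [rawBeta_sub hφ (kernelIntegrable_affine hγ₁ hγ₂ v p) hc, rawBeta_affine hγ₁ hγ₂ v p hc]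
  have hval {c : ℝ} (hc : 0 < c) (h : (∫ r in Ioi (0 : ℝ), φ (c * r) * f r) = φ c) :
      φ c ∈ Ioo (0 : ℝ) 1 :=
    fixedPoint_mem_Ioo hγ₁ hγ₂ hφ hφ01 hφ0 hφtop hbs hconv hc (hraw hc h)
  have hlower {c p : ℝ} (hc : 0 < c) (hcb : c ≤ bs)
      (h : (∫ r in Ioi (0 : ℝ), φ (c * r) * f r) = φ c)
      (hp : ∀ x ∈ Icc (0 : ℝ) bs, φ c + p * (x - c) ≤ φ x) :
      0 < lowerMoment γ₂ (fun s => φ s - (φ c - p * c + p * s)) c := by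
    obtain ⟨x, hx, hxc, hpos⟩ := exists_pos_gap hc hcb hφ0 (hval hc h).1 hnear0 hp
    exact lowerMoment_pos (hψ _ p c hc).1
      (fun s hs => by linarith [hp s ⟨hs.1.le, hs.2.trans hcb⟩]) hx hxc hpos
  have hupper {c p : ℝ} (hc : 0 < c) (hcb : bs ≤ c)
      (h : (∫ r in Ioi (0 : ℝ), φ (c * r) * f r) = φ c)
      (hp : ∀ x ∈ Ici bs, φ x ≤ φ c + p * (x - c)) :
      upperMoment γ₁ (fun s => φ s - (φ c - p * c + p * s)) c < 0 := by
    obtain ⟨K, hneg⟩ := exists_neg_gap hcb (fun x => (hφ01 x).2) hφtop (hval hc h).2 hp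
    exact upperMoment_neg hc (hψ _ p c hc).2
      (fun s hs => by linarith [hp s (hcb.trans (mem_Ioi.1 hs).le)]) hneg
  have hzero {c : ℝ} (p : ℝ) (hc : 0 < c)
      (h : (∫ r in Ioi (0 : ℝ), φ (c * r) * f r) = φ c) :
      rawBeta γ₁ γ₂ (fun s => φ s - (φ c - p * c + p * s)) c = 0 := by
    rw [hrawψ _ _ hc, hraw hc h]; ring
  constructor
  · intro p hp d hd
    have hD : HasDerivAt (rawBeta γ₁ γ₂ (fun s => φ s - (φ b - p * b + p * s)))
        ((γ₂ - γ₁) * (d - p)) b := by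
      have hlin : HasDerivAt (fun c : ℝ => φ b - p * b + p * c) p b := by
        simpa using ((hasDerivAt_id b).const_mul p).const_add (φ b - p * b)
      refine ((hd.sub hlin).const_mul (γ₂ - γ₁)).congr_of_eventuallyEq
        (mem_of_superset (Ioi_mem_nhds hb) fun c hc => ?_)
      simp only [mem_ofPred_eq, Pi.sub_apply]
      rw [hrawψ _ _ hc, hβ hc, mul_sub, mul_inv_cancel_left₀ hn.ne']
    refine neg_of_mul_neg_right (deriv_rawBeta_neg hγ₁ hγ₂ (hψ _ p) hb (by ring)
      (hzero p hb hfix) hD ?_) hn.le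
    refine hp.imp (fun ⟨h, hp⟩ => ⟨hlower hb h hfix hp, ?_⟩)
      (fun ⟨h, hp⟩ => ⟨hupper hb h hfix hp, ?_⟩)
    · exact (hconv.continuousWithinAt_Iic_of_support hb h hp).sub (by fun_prop)
    · exact (hconc.continuousWithinAt_Ioi_of_support h hp).sub (by fun_prop)
  · have hnot : ∀ b₁ b₂ : ℝ, 0 < b₁ → b₁ < b₂ →
        (∫ r in Ioi (0 : ℝ), φ (b₁ * r) * f r) = φ b₁ →
        (∫ r in Ioi (0 : ℝ), φ (b₂ * r) * f r) = φ b₂ → False := by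
      intro b₁ b₂ hb₁ h h₁ h₂
      have hb₂ := hb₁.trans h
      have hleft {p : ℝ} (hb₁s : b₁ ≤ bs) (hp : ∀ x ∈ Icc (0 : ℝ) bs, φ b₁ + p * (x - b₁) ≤ φ x)
          (hinc : ∀ s ∈ Icc b₁ b₂, p * (s - b₁) ≤ φ s - φ b₁ ∧ p * (b₂ - s) ≤ φ b₂ - φ s) :
          False := by
        have := rawBeta_lt_of_nonneg hγ₁ hγ₂ (hψ (φ b₁ - p * b₁) p) hb₁ h (hlower hb₁ hb₁s h₁ hp)
          (fun s hs => by
            obtain ⟨i₁, i₂⟩ := hinc s (Ioc_subset_Icc_self hs)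
            constructor <;> linarith)
          (hzero p hb₁ h₁)
        rw [hrawψ _ _ hb₂, hraw hb₂ h₂] at this
        linarith
      have hright {q : ℝ} (hb₂s : bs ≤ b₂) (hq : ∀ x ∈ Ici bs, φ x ≤ φ b₂ + q * (x - b₂))
          (hinc : ∀ s ∈ Icc b₁ b₂, q * (s - b₁) ≤ φ s - φ b₁ ∧ q * (b₂ - s) ≤ φ b₂ - φ s) :
          False := by
        have := lt_rawBeta_of_nonpos hγ₁ hγ₂ (hψ (φ b₂ - q * b₂) q) hb₁ h (hupper hb₂ hb₂s h₂ hq)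
          (fun s hs => by
            obtain ⟨i₁, i₂⟩ := hinc s hs
            constructor <;> linarith)
          (hzero q hb₂ h₂)
        rw [hrawψ _ _ hb₁, hraw hb₁ h₁] at this
        linarith
      have hincp (hb₁s : b₁ < bs) : ∃ p, (∀ x ∈ Icc (0 : ℝ) bs, φ b₁ + p * (x - b₁) ≤ φ x) ∧
          ∀ x y, b₁ ≤ x → x ≤ y → y ≤ bs → p * (y - x) ≤ φ y - φ x := by
        obtain ⟨p, hp⟩ := hconv.exists_subgradient
          (x := b₁) (by rw [interior_Icc]; exact ⟨hb₁, hb₁s⟩)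
        exact ⟨p, hp, fun x y hx hxy hy => hconv.mul_sub_le_sub ⟨hb₁.le, hb₁s.le⟩
          ⟨hb₁.le.trans (hx.trans hxy), hy⟩ hx hxy hp⟩
      have hincq (hb₂s : bs < b₂) : ∃ q, (∀ x ∈ Ici bs, φ x ≤ φ b₂ + q * (x - b₂)) ∧
          ∀ x y, bs ≤ x → x ≤ y → y ≤ b₂ → q * (y - x) ≤ φ y - φ x := by
        obtain ⟨q, hq⟩ := hconc.exists_supergradient
          (x := b₂) (by rw [interior_Ici]; exact hb₂s)
        exact ⟨q, hq, fun x y hx hxy hy => hconc.mul_sub_le_sub hb₂s.le hx hxy hy hq⟩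
      rcases le_or_gt b₂ bs with hb₂s | hb₂s
      · obtain ⟨p, hp, hi⟩ := hincp (h.trans_le hb₂s)
        exact hleft (h.le.trans hb₂s) hp fun s hs =>
          ⟨hi b₁ s le_rfl hs.1 (hs.2.trans hb₂s), hi s b₂ hs.1 hs.2 hb₂s⟩
      obtain ⟨q, hq, hj⟩ := hincq hb₂s
      rcases le_or_gt bs b₁ with hb₁s | hb₁s
      · exact hright hb₂s.le hq fun s hs =>
          ⟨hj b₁ s hb₁s hs.1 hs.2, hj s b₂ (hb₁s.trans hs.1) hs.2 le_rfl⟩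
      obtain ⟨p, hp, hi⟩ := hincp hb₁s
      have hglue {m : ℝ} (hmp : m ≤ p) (hmq : m ≤ q) (x y : ℝ) (hx : b₁ ≤ x) (hxy : x ≤ y)
          (hy : y ≤ b₂) : m * (y - x) ≤ φ y - φ x := by
        have hl {x y : ℝ} (hx : b₁ ≤ x) (hxy : x ≤ y) (hy : y ≤ bs) : m * (y - x) ≤ φ y - φ x :=
          (mul_le_mul_of_nonneg_right hmp (sub_nonneg.2 hxy)).trans (hi x y hx hxy hy)
        have hr {x y : ℝ} (hx : bs ≤ x) (hxy : x ≤ y) (hy : y ≤ b₂) : m * (y - x) ≤ φ y - φ x :=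
          (mul_le_mul_of_nonneg_right hmq (sub_nonneg.2 hxy)).trans (hj x y hx hxy hy)
        rcases le_total y bs with h | h
        · exact hl hx hxy h
        rcases le_total bs x with h' | h'
        · exact hr h' hxy hy
        · linarith [hl hx h' le_rfl, hr le_rfl h hy]
      rcases le_total p q with hpq | hpq
      · exact hleft hb₁s.le hp fun s hs =>
          ⟨hglue le_rfl hpq b₁ s le_rfl hs.1 hs.2, hglue le_rfl hpq s b₂ hs.1 hs.2 le_rfl⟩
      · exact hright hb₂s.le hq fun s hs =>
          ⟨hglue hpq le_rfl b₁ s le_rfl hs.1 hs.2, hglue hpq le_rfl s b₂ hs.1 hs.2 le_rfl⟩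
    intro b' hb' hfix'
    rcases lt_trichotomy b' b with h | h | h
    · exact (hnot b' b hb' h hfix' hfix).elim
    · exact h
    · exact (hnot b b' hb h hfix hfix').elim
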